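/- Let p ∈ 𝔽₂[X] be an irreducible polynomial of degree n ≥ 2. Then there exist exactly two rule vectors d ∈ 𝔽₂^n of length n whose LHCA transition matrix A(d) has characteristic polynomial p, and these two rule vectors are mirror images (reversals) of each other: if d = [d_0,…,d_{n-1}] is one of them, then the other is [d_{n-1},…,d_0]. -/

import Mathlib

open Polynomial

/-- Transition matrix of a null-boundary linear hybrid CA over 𝔽₂ with rule
vector `d`: tridiagonal, diagonal entries `d i`, sub/super-diagonal entries 1. -/
def lhcaMatrix (N : ℕ) (d : Fin N → ZMod 2) : Matrix (Fin N) (Fin N) (ZMod 2) :=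
  Matrix.of fun i j =>
    if i = j then d i
    else if (i : ℕ) + 1 = (j : ℕ) ∨ (j : ℕ) + 1 = (i : ℕ) then 1 else 0

/-- Characteristic polynomial of the LHCA transition matrix. -/
noncomputable def lhcaCharPoly (N : ℕ) (d : Fin N → ZMod 2) : Polynomial (ZMod 2) :=
  (lhcaMatrix N d).charpoly

namespace LHCA

/-- The quadratic invariant. -/
noncomputable def E (p q : (ZMod 2)[X]) : (ZMod 2)[X] :=
  (X ^ 2 + X) * (derivative q * p + q * derivative p) + q * p + q ^ 2 + p ^ 2

/-- Continuant together with the continuant of the tail. -/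
noncomputable def PQ : List (ZMod 2) → (ZMod 2)[X] × (ZMod 2)[X]
  | [] => (1, 0)
  | a :: l => ((X + C a) * (PQ l).1 + (PQ l).2, (PQ l).1)

/-- Transfer matrix. -/
noncomputable def B (a : ZMod 2) : Matrix (Fin 2) (Fin 2) (ZMod 2)[X] := !![X + C a, 1; 1, 0]

lemma two_zero : (2 : (ZMod 2)[X]) = 0 := CharTwo.two_eq_zero

lemma C_sq (a : ZMod 2) : (C a : (ZMod 2)[X]) ^ 2 = C a := by
  rw [← C_pow]; congr 1; revert a; decide

lemma E_quot (a p q : (ZMod 2)[X]) :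
    E (a * p + q) p = E p q + p ^ 2 * ((X ^ 2 + X) * derivative a + a + a ^ 2) := by
  have h := two_zero
  simp only [E, derivative_add, derivative_mul]
  grind

lemma E_step (a : ZMod 2) (p q : (ZMod 2)[X]) :
    E ((X + C a) * p + q) p = E p q := by
  have h := two_zero
  have h1 := C_sq a
  rw [E_quot]
  simp only [derivative_add, derivative_X, derivative_C]
  grind

lemma E_PQ (l : List (ZMod 2)) : E (PQ l).1 (PQ l).2 = 1 := by
  induction l with
  | nil => simp [PQ, E]
  | cons a l ih => simp only [PQ]; rw [E_step, ih]

lemma PQ_deg (l : List (ZMod 2)) : (PQ l).1.Monic ∧ (PQ l).1.natDegree = l.length ∧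
    (PQ l).2.degree < (PQ l).1.degree := by
  induction l with
  | nil => simp [PQ]
  | cons a l ih =>
    obtain ⟨h1, h2, h3⟩ := ih
    have hm : ((X + C a) * (PQ l).1).Monic := (monic_X_add_C a).mul h1
    have hd : ((X + C a) * (PQ l).1).natDegree = l.length + 1 := by
      rw [(monic_X_add_C a).natDegree_mul h1, h2, natDegree_X_add_C]; omega
    have hlt : (PQ l).1.degree < ((X + C a) * (PQ l).1).degree := by
      rw [degree_eq_natDegree hm.ne_zero, degree_eq_natDegree h1.ne_zero, hd, h2]
      exact_mod_cast Nat.lt_succ_self _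
    have hlt2 := h3.trans hlt
    refine ⟨hm.add_of_left hlt2, ?_, ?_⟩
    · simp only [PQ]
      rw [natDegree_add_eq_left_of_degree_lt hlt2, hd]; simp
    · simp only [PQ]
      rw [degree_add_eq_left_of_degree_lt hlt2]; exact hlt

lemma PQ_inj (l l' : List (ZMod 2)) (h : PQ l = PQ l') : l = l' := by
  induction l generalizing l' with
  | nil =>
    have := (PQ_deg l').2.1
    rw [← h] at this
    simp [PQ] at this
    exact (List.length_eq_zero_iff.mp this.symm).symm
  | cons a l ih =>
    cases l' with
    | nil =>
      have := (PQ_deg (a :: l)).2.1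
      rw [h] at this
      simp [PQ] at this
    | cons b l' =>
      simp only [PQ, Prod.mk.injEq] at h
      obtain ⟨h1, h2⟩ := h
      have e : C (a - b) * (PQ l).1 = (PQ l').2 - (PQ l).2 := by
        rw [← h2] at h1
        rw [C_sub]; linear_combination h1
      have hd : ((PQ l').2 - (PQ l).2).degree < (PQ l).1.degree := by
        refine (degree_sub_le _ _).trans_lt (max_lt ?_ (PQ_deg l).2.2)
        rw [h2]; exact (PQ_deg l').2.2
      have hab : a = b := by
        by_contra hne
        rw [← e, degree_C_mul (sub_ne_zero.mpr hne)] at hd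
        exact lt_irrefl _ hd
      subst hab
      rw [ih l' (Prod.ext h2 ?_)]
      rw [sub_self, C_0, zero_mul] at e
      exact (sub_eq_zero.mp e.symm).symm

lemma monic_of_ne {p : (ZMod 2)[X]} (h : p ≠ 0) : p.Monic := by
  have : ∀ x : ZMod 2, x ≠ 0 → x = 1 := by decide
  exact this _ (leadingCoeff_ne_zero.mpr h)

lemma E_natDegree (q r : (ZMod 2)[X]) (h : r.degree < q.degree) :
    (E q r).natDegree ≤ 2 * q.natDegree := by
  by_cases hr : r = 0
  · subst hr; simp [E, natDegree_pow]
  have hl : r.natDegree < q.natDegree := natDegree_lt_natDegree hr h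
  have h1 : (derivative r).natDegree ≤ r.natDegree - 1 := natDegree_derivative_le r
  have h2 : (derivative q).natDegree ≤ q.natDegree - 1 := natDegree_derivative_le q
  have hx : ((X : (ZMod 2)[X]) ^ 2 + X).natDegree ≤ 2 := by compute_degree
  have hA : (derivative r * q).natDegree ≤ 2 * q.natDegree - 2 := by
    by_cases h0 : derivative r = 0
    · simp [h0]
    have : r.natDegree ≠ 0 := fun h' => h0 (derivative_of_natDegree_zero h')
    refine natDegree_mul_le.trans ?_; omega
  have hB : (r * derivative q).natDegree ≤ 2 * q.natDegree - 2 := by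
    refine natDegree_mul_le.trans ?_; omega
  have hC : (r * q).natDegree ≤ 2 * q.natDegree := natDegree_mul_le.trans (by omega)
  have hD : (r ^ 2).natDegree ≤ 2 * q.natDegree := natDegree_pow_le.trans (by omega)
  have hF : (q ^ 2).natDegree ≤ 2 * q.natDegree := natDegree_pow_le.trans (by omega)
  refine natDegree_add_le_of_degree_le (natDegree_add_le_of_degree_le
    (natDegree_add_le_of_degree_le ?_ hC) hD) hF
  refine natDegree_mul_le.trans ?_
  have := natDegree_add_le_of_degree_le hA hB
  omega

lemma exists_list (n : ℕ) : ∀ p q : (ZMod 2)[X], p.natDegree = n → q.degree < p.degree →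
    E p q = 1 → ∃ l, PQ l = (p, q) := by
  induction n using Nat.strong_induction_on with
  | _ n ih =>
  intro p q hn hd hE
  by_cases hq : q = 0
  · subst hq
    have hp : p ^ 2 = 1 := by simpa [E] using hE
    have hp0 : p ≠ 0 := by rintro rfl; simp at hp
    have : p = 1 := by
      have h2 := congrArg natDegree hp
      rw [natDegree_pow, natDegree_one] at h2
      exact (monic_of_ne hp0).natDegree_eq_zero.mp (by omega)
    exact ⟨[], by simp [PQ, this]⟩
  · have hlt := natDegree_lt_natDegree hq hd
    have hdiv : p = (p / q) * q + p % q := by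
      rw [mul_comm]; exact (EuclideanDomain.div_add_mod p q).symm
    have hr : (p % q).degree < q.degree := EuclideanDomain.mod_lt p hq
    set a := p / q with ha
    set r := p % q with hr'
    have hdega : a.natDegree + q.natDegree = p.natDegree := by
      have h3 : a.degree + q.degree = p.degree := by
        rw [add_comm]; exact degree_add_div hq hd.le
      have ha0 : a ≠ 0 := by
        intro h0; rw [h0, zero_mul, zero_add] at hdiv; rw [← hdiv] at hr
        exact lt_asymm hr hd
      rw [degree_eq_natDegree ha0, degree_eq_natDegree hq,
        degree_eq_natDegree (ne_zero_of_degree_gt hd)] at h3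
      exact_mod_cast h3
    rw [hdiv, E_quot] at hE
    have hEd := E_natDegree q r hr
    have ha1 : a.natDegree = 1 := by
      by_contra hne
      have h2 : 2 ≤ a.natDegree := by omega
      have hx : ((X : (ZMod 2)[X]) ^ 2 + X).natDegree ≤ 2 := by compute_degree
      have h1 : (derivative a).natDegree ≤ a.natDegree - 1 := natDegree_derivative_le a
      have hS : ((X ^ 2 + X) * derivative a + a + a ^ 2).natDegree = 2 * a.natDegree := by
        rw [natDegree_add_eq_right_of_natDegree_lt, natDegree_pow]
        rw [natDegree_pow]
        have h5 : ((X ^ 2 + X) * derivative a).natDegree ≤ a.natDegree + 1 :=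
          natDegree_mul_le.trans (by omega)
        have := natDegree_add_le_of_degree_le h5 (show a.natDegree ≤ a.natDegree + 1 by omega)
        omega
      have hS0 : ((X ^ 2 + X) * derivative a + a + a ^ 2) ≠ 0 := by
        intro h0; rw [h0] at hS; simp at hS; omega
      have hT := natDegree_mul (pow_ne_zero 2 hq) hS0
      rw [hS, natDegree_pow] at hT
      have hU : (E q r + q ^ 2 * ((X ^ 2 + X) * derivative a + a + a ^ 2)).natDegree
          = 2 * q.natDegree + 2 * a.natDegree := by
        rw [natDegree_add_eq_right_of_natDegree_lt, hT]
        omega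
      rw [hE, natDegree_one] at hU
      omega
    have hma : a.Monic := monic_of_ne (by rintro h; rw [h] at ha1; simp at ha1)
    have hax : a = X + C (a.coeff 0) := hma.eq_X_add_C ha1
    rw [← E_quot, hax, E_step] at hE
    obtain ⟨l, hl⟩ := ih q.natDegree (by omega) q r rfl hr hE
    refine ⟨a.coeff 0 :: l, ?_⟩
    simp only [PQ, hl]
    rw [← hax, ← hdiv]

lemma M_col (l : List (ZMod 2)) :
    (l.map B).prod 0 0 = (PQ l).1 ∧ (l.map B).prod 1 0 = (PQ l).2 := by
  induction l with
  | nil => simp [PQ]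
  | cons a l ih =>
    simp [PQ, Matrix.mul_apply, Fin.sum_univ_two, ih.1, ih.2, B]

lemma M_rev (l : List (ZMod 2)) : (l.reverse.map B).prod = ((l.map B).prod).transpose := by
  have hB : ∀ a, (B a).transpose = B a := by
    intro a; ext i j; fin_cases i <;> fin_cases j <;> simp [B]
  rw [Matrix.transpose_list_prod, List.map_map, List.map_reverse]
  congr 2
  exact List.map_congr_left fun a _ => (hB a).symm

lemma M_det (l : List (ZMod 2)) : ((l.map B).prod).det = 1 := by
  induction l with
  | nil => simp
  | cons a l ih =>
    rw [List.map_cons, List.prod_cons, Matrix.det_mul, ih]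
    have := two_zero
    simp only [B, Matrix.det_fin_two_of]
    grind

lemma PQ_rev (l : List (ZMod 2)) : (PQ l.reverse).1 = (PQ l).1 ∧
    (PQ l).1 ∣ (PQ l).2 * (PQ l.reverse).2 - 1 := by
  have h1 := M_col l
  have h2 := M_col l.reverse
  rw [M_rev] at h2
  simp only [Matrix.transpose_apply] at h2
  have h3 := M_det l
  rw [Matrix.det_fin_two] at h3
  refine ⟨by rw [← h2.1, h1.1], ?_⟩
  rw [h1.1, h1.2, h2.2] at h3
  refine ⟨(l.map B).prod 1 1 - 2 * ((l.map B).prod 1 1), ?_⟩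
  have := two_zero
  grind

lemma charmatrix_lhca (n : ℕ) (d : Fin n → ZMod 2) (i j : Fin n) :
    (lhcaMatrix n d).charmatrix i j = if i = j then X + C (d i)
      else if (i : ℕ) + 1 = (j : ℕ) ∨ (j : ℕ) + 1 = (i : ℕ) then 1 else 0 := by
  by_cases h : i = j
  · subst h
    simp [Matrix.charmatrix_apply_eq, lhcaMatrix, CharTwo.sub_eq_add]
  · rw [Matrix.charmatrix_apply_ne _ _ _ h]
    simp only [lhcaMatrix, Matrix.of_apply, if_neg h, CharTwo.neg_eq]
    split_ifs <;> simp

lemma charpoly_rec (n : ℕ) (d : Fin (n + 2) → ZMod 2) :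
    lhcaCharPoly (n + 2) d = (X + C (d 0)) * lhcaCharPoly (n + 1) (fun i => d i.succ)
      + lhcaCharPoly n (fun i => d i.succ.succ) := by
  simp only [lhcaCharPoly, Matrix.charpoly]
  rw [Matrix.det_succ_row_zero, Fin.sum_univ_succ, Fin.sum_univ_succ]
  have h0 : ∀ i : Fin n, (lhcaMatrix (n + 2) d).charmatrix 0 i.succ.succ = 0 := by
    intro i
    rw [charmatrix_lhca, if_neg (Fin.succ_ne_zero _).symm, if_neg]
    simp
  have h1 : (lhcaMatrix (n + 2) d).charmatrix.submatrix Fin.succ (Fin.succAbove 0)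
      = (lhcaMatrix (n + 1) (fun i => d i.succ)).charmatrix := by
    ext1 i j
    rw [Matrix.submatrix_apply, charmatrix_lhca, charmatrix_lhca]
    simp
  have h2 : ((lhcaMatrix (n + 2) d).charmatrix.submatrix Fin.succ
      (Fin.succAbove (Fin.succ 0))).det
      = (lhcaMatrix n (fun i => d i.succ.succ)).charmatrix.det := by
    rw [Matrix.det_succ_column_zero, Fin.sum_univ_succ]
    have h3 : ∀ i : Fin n, (lhcaMatrix (n + 2) d).charmatrix.submatrix Fin.succ
      (Fin.succAbove (Fin.succ 0)) i.succ 0 = 0 := by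
      intro i
      rw [Matrix.submatrix_apply, charmatrix_lhca, Fin.succ_succAbove_zero,
        if_neg (Fin.succ_ne_zero _), if_neg]
      simp
    have h4 : ((lhcaMatrix (n + 2) d).charmatrix.submatrix Fin.succ
      (Fin.succAbove (Fin.succ 0))).submatrix (Fin.succAbove 0) Fin.succ
        = (lhcaMatrix n (fun i => d i.succ.succ)).charmatrix := by
      ext1 i j
      rw [Matrix.submatrix_apply, Matrix.submatrix_apply, charmatrix_lhca, charmatrix_lhca]
      simp
    have h5 : (lhcaMatrix (n + 2) d).charmatrix.submatrix Fin.succ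
      (Fin.succAbove (Fin.succ 0)) 0 0 = 1 := by
      rw [Matrix.submatrix_apply, charmatrix_lhca, Fin.succ_succAbove_zero,
        if_neg (Fin.succ_ne_zero _), if_pos]
      simp
    rw [h5, h4]
    simp only [h3]
    simp
  have h6 : (lhcaMatrix (n + 2) d).charmatrix 0 0 = X + C (d 0) := by
    rw [charmatrix_lhca, if_pos rfl]
  have h7 : (lhcaMatrix (n + 2) d).charmatrix 0 (Fin.succ 0) = 1 := by
    rw [charmatrix_lhca, if_neg (Fin.succ_ne_zero _).symm, if_pos]
    simp
  rw [h1, h2, h6, h7]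
  simp only [h0]
  simp [CharTwo.neg_eq]

lemma charpoly_eq (n : ℕ) : ∀ d : Fin n → ZMod 2, lhcaCharPoly n d = (PQ (List.ofFn d)).1 := by
  induction n using Nat.strong_induction_on with
  | _ n ih =>
  intro d
  match n, ih, d with
  | 0, _, d => simp [PQ, lhcaCharPoly, Matrix.charpoly]
  | 1, _, d =>
    simp [PQ, lhcaCharPoly, Matrix.charpoly, lhcaMatrix, CharTwo.sub_eq_add]
  | n + 2, ih, d =>
    rw [charpoly_rec, ih (n + 1) (by omega), ih n (by omega), List.ofFn_succ, List.ofFn_succ]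
    simp [PQ]

/-- The additive part of `E p`. -/
noncomputable def L (p : (ZMod 2)[X]) : (ZMod 2)[X] →ₗ[ZMod 2] (ZMod 2)[X] :=
  AddMonoidHom.toZModLinearMap 2
    { toFun := fun q => (X ^ 2 + X) * (derivative q * p + q * derivative p) + q * p + q ^ 2
      map_zero' := by simp
      map_add' := fun a b => by
        have := two_zero
        simp only [derivative_add]
        grind }

lemma L_apply (p q : (ZMod 2)[X]) : L p q =
    (X ^ 2 + X) * (derivative q * p + q * derivative p) + q * p + q ^ 2 := rfl

lemma E_eq (p q : (ZMod 2)[X]) : E p q = L p q + p ^ 2 := by rw [L_apply, E]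

/-- Squaring after multiplication with `X² + X`. -/
noncomputable def S : (ZMod 2)[X] →ₗ[ZMod 2] (ZMod 2)[X] :=
  AddMonoidHom.toZModLinearMap 2
    { toFun := fun s => ((X ^ 2 + X) * s) ^ 2
      map_zero' := by simp
      map_add' := fun a b => by
        have := two_zero
        grind }

lemma S_apply (s : (ZMod 2)[X]) : S s = ((X ^ 2 + X) * s) ^ 2 := rfl

lemma deriv_deriv (p : (ZMod 2)[X]) : derivative (derivative p) = 0 := by
  ext n
  rw [coeff_derivative, coeff_derivative]
  have h : ∀ a : ZMod 2, (a + 1) * a = 0 := by decide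
  have := h ((n : ZMod 2) + 1)
  push_cast
  rw [mul_assoc, this]; simp

lemma deriv_L (p q : (ZMod 2)[X]) : derivative (L p q) = 0 := by
  have h2 := two_zero
  rw [L_apply]
  simp only [derivative_add, derivative_mul, derivative_pow, derivative_X, deriv_deriv]
  simp only [Nat.cast_ofNat, map_ofNat, h2]
  grind

lemma exists_sqrt (f : (ZMod 2)[X]) (h : derivative f = 0) : ∃ g, f = g ^ 2 := by
  have h1 := expand_contract 2 h (by norm_num)
  refine ⟨contract 2 f, ?_⟩
  conv_lhs => rw [← h1]
  exact ZMod.expand_card (p := 2) _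

lemma dvd_of_eval {g : (ZMod 2)[X]} (h0 : g.eval 0 = 0) (h1 : g.eval 1 = 0) :
    X ^ 2 + X ∣ g := by
  have e : (X ^ 2 + X : (ZMod 2)[X]) = (X - C 0) * (X - C 1) := by
    have := two_zero
    simp only [C_0, C_1]; grind
  rw [e]
  refine IsCoprime.mul_dvd ?_ (dvd_iff_isRoot.mpr h0) (dvd_iff_isRoot.mpr h1)
  exact ⟨1, -1, by simp⟩

lemma q_monic : (X ^ 2 + X : (ZMod 2)[X]).Monic := by monicity!
lemma q_natDegree : (X ^ 2 + X : (ZMod 2)[X]).natDegree = 2 := by compute_degree!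

lemma L_mem {n : ℕ} (hn : 2 ≤ n) {p q : (ZMod 2)[X]} (hpn : p.natDegree = n)
    (h0 : p.eval 0 = 1) (h1 : p.eval 1 = 1) (hq : q.degree < p.degree) :
    ∃ s ∈ degreeLT (ZMod 2) (n - 1), L p q = S s := by
  obtain ⟨g, hg⟩ := exists_sqrt _ (deriv_L p q)
  have e0 : g.eval 0 = 0 := by
    have := congrArg (eval 0) hg
    rw [L_apply] at this
    simp [h0, CharTwo.add_self_eq_zero] at this
    exact this.symm
  have e1 : g.eval 1 = 0 := by
    have := congrArg (eval 1) hg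
    rw [L_apply] at this
    simp [h1, add_assoc, CharTwo.add_self_eq_zero] at this
    exact this.symm
  obtain ⟨s, hs⟩ := dvd_of_eval e0 e1
  refine ⟨s, ?_, by rw [hg, hs, S_apply]⟩
  by_cases hs0 : s = 0
  · rw [hs0]; exact zero_mem _
  have hgd : (g ^ 2).natDegree ≤ 2 * n := by
    have hE := E_natDegree p q hq
    have : g ^ 2 = E p q + p ^ 2 := by
      have := two_zero
      rw [E_eq, hg]; grind
    rw [this]
    refine natDegree_add_le_of_degree_le (hpn ▸ hE) (natDegree_pow_le.trans (by omega))
  have hgd2 : g.natDegree = 2 + s.natDegree := by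
    rw [hs, natDegree_mul q_monic.ne_zero hs0, q_natDegree]
  rw [natDegree_pow] at hgd
  rw [mem_degreeLT, degree_eq_natDegree hs0]
  have : s.natDegree < n - 1 := by omega
  exact_mod_cast this

lemma ker_dvd {p k : (ZMod 2)[X]} (h : L p k = 0) : p ∣ k * (k + (X ^ 2 + X) * derivative p) := by
  refine ⟨(X ^ 2 + X) * derivative k + k, ?_⟩
  have := two_zero
  rw [L_apply] at h
  grind

lemma eq_of_dvd {p a b : (ZMod 2)[X]} (ha : a.degree < p.degree) (hb : b.degree < p.degree)
    (h : p ∣ a - b) : a = b := by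
  rw [← sub_eq_zero]
  exact eq_zero_of_dvd_of_degree_lt h ((degree_sub_le _ _).trans_lt (max_lt ha hb))

lemma exists_q {n : ℕ} (hn : 2 ≤ n) {p : (ZMod 2)[X]} (hp : Irreducible p)
    (hpn : p.natDegree = n) : ∃ q, q.degree < p.degree ∧ E p q = 1 := by
  have hev : ∀ a, p.eval a = 1 := by
    intro a
    have : ∀ x : ZMod 2, x ≠ 0 → x = 1 := by decide
    apply this
    intro h
    have := degree_eq_one_of_irreducible_of_root hp h
    have h' : p.natDegree = 1 := natDegree_eq_of_degree_eq_some this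
    omega
  have hpd : p.degree = n := by rw [degree_eq_natDegree hp.ne_zero, hpn]
  set D := degreeLT (ZMod 2) n
  have hD : ∀ q, q ∈ D ↔ q.degree < p.degree := fun q => by rw [hpd]; exact mem_degreeLT
  have fD : ∀ m, Module.finrank (ZMod 2) (degreeLT (ZMod 2) m) = m := fun m => by
    rw [(degreeLTEquiv (ZMod 2) m).finrank_eq]; simp
  have fin : ∀ m, FiniteDimensional (ZMod 2) (degreeLT (ZMod 2) m) := fun m =>
    (degreeLTEquiv (ZMod 2) m).symm.finiteDimensional
  let L' := (L p).domRestrict D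
  let S' := S.domRestrict (degreeLT (ZMod 2) (n - 1))
  have hle : LinearMap.range L' ≤ LinearMap.range S' := by
    rintro _ ⟨⟨q, hq⟩, rfl⟩
    obtain ⟨s, hs, e⟩ := L_mem hn hpn (hev 0) (hev 1) ((hD q).mp hq)
    exact ⟨⟨s, hs⟩, e.symm⟩
  have hS : Module.finrank (ZMod 2) (LinearMap.range S') ≤ n - 1 :=
    (LinearMap.finrank_range_le S').trans (fD _).le
  have hker : Module.finrank (ZMod 2) (LinearMap.ker L') ≤ 1 := by
    by_cases hbot : ∀ k ∈ LinearMap.ker L', k = 0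
    · have : LinearMap.ker L' = ⊥ := (Submodule.eq_bot_iff _).mpr hbot
      rw [this]; simp
    push Not at hbot
    obtain ⟨k, hk, hk0⟩ := hbot
    have key : ∀ k ∈ LinearMap.ker L', k ≠ 0 → p ∣ (k : (ZMod 2)[X]) + (X ^ 2 + X) * derivative p := by
      rintro ⟨k, hkD⟩ hk hk0
      have hk' : L p k = 0 := hk
      rcases hp.prime.dvd_or_dvd (ker_dvd hk') with h | h
      · exfalso; apply hk0
        have := eq_zero_of_dvd_of_degree_lt h ((hD k).mp hkD)
        exact Subtype.ext this
      · exact h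
    refine finrank_le_one (⟨k, hk⟩ : LinearMap.ker L') ?_
    rintro ⟨m, hm⟩
    by_cases hm0 : m = 0
    · exact ⟨0, by ext1; simp [hm0]⟩
    · refine ⟨1, ?_⟩
      have h3 := dvd_sub (key k hk hk0) (key m hm hm0)
      rw [add_sub_add_right_eq_sub] at h3
      have := eq_of_dvd ((hD _).mp k.2) ((hD _).mp m.2) h3
      rw [one_smul]
      exact Subtype.ext (Subtype.ext this)
  have hrn := LinearMap.finrank_range_add_finrank_ker L'
  rw [fD] at hrn
  have heq : LinearMap.range L' = LinearMap.range S' :=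
    Submodule.eq_of_le_of_finrank_le hle (by omega)
  obtain ⟨s, hs⟩ : X ^ 2 + X ∣ p + 1 :=
    dvd_of_eval (by simp [hev, CharTwo.add_self_eq_zero]) (by simp [hev, CharTwo.add_self_eq_zero])
  have hsD : s ∈ degreeLT (ZMod 2) (n - 1) := by
    by_cases hs0 : s = 0
    · rw [hs0]; exact zero_mem _
    have hgd : (p + 1).natDegree = n := by
      rw [← hpn]; exact natDegree_add_C (a := (1 : ZMod 2))
    rw [hs, natDegree_mul q_monic.ne_zero hs0, q_natDegree] at hgd
    rw [mem_degreeLT, degree_eq_natDegree hs0]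
    have : s.natDegree < n - 1 := by omega
    exact_mod_cast this
  have hmem : S s ∈ LinearMap.range L' := heq ▸ ⟨⟨s, hsD⟩, rfl⟩
  obtain ⟨⟨q, hq⟩, e⟩ := hmem
  have e' : L p q = S s := e
  refine ⟨q, (hD q).mp hq, ?_⟩
  rw [E_eq, e', S_apply, ← hs]
  have := two_zero
  grind

lemma c_ndvd {p : (ZMod 2)[X]} (hp : Irreducible p) (hn : 2 ≤ p.natDegree) :
    ¬ p ∣ (X ^ 2 + X) * derivative p := by
  intro h
  rcases hp.prime.dvd_or_dvd h with h | h
  · have e : (X ^ 2 + X : (ZMod 2)[X]) = X * (X + C 1) := by rw [C_1]; ring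
    rw [e] at h
    rcases hp.prime.dvd_or_dvd h with h | h
    · have := natDegree_le_of_dvd h X_ne_zero
      rw [natDegree_X] at this; omega
    · have := natDegree_le_of_dvd h (X_add_C_ne_zero 1)
      rw [natDegree_X_add_C] at this; omega
  · have hs : p.Separable := PerfectField.separable_of_irreducible hp
    exact hp.not_isUnit (hs.isUnit_of_dvd' dvd_rfl h)

end LHCA

open LHCA

/-- An irreducible polynomial `p ∈ 𝔽₂[X]` of degree `n ≥ 2` has exactly two
LHCA realizations, and they are reversals (mirror images) of each other: the
set of rule vectors realizing `p` is `{d, reverse d}` with `reverse d ≠ d`. -/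
theorem irreducible_two_lhca_realizations (n : ℕ) (hn : 2 ≤ n)
    (p : Polynomial (ZMod 2)) (hp : Irreducible p) (hpdeg : p.natDegree = n) :
    ∃ d : Fin n → ZMod 2,
      (fun i => d i.rev) ≠ d ∧
      {d' : Fin n → ZMod 2 | lhcaCharPoly n d' = p} = {d, fun i => d i.rev} := by
  have h2 := two_zero
  obtain ⟨q, hqd, hqE⟩ := exists_q hn hp hpdeg
  obtain ⟨l, hl⟩ := exists_list n p q hpdeg hqd hqE
  have hlen : l.length = n := by
    have := (PQ_deg l).2.1
    rw [hl] at this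
    rw [← this]; exact hpdeg
  obtain ⟨d, rfl⟩ : ∃ d : Fin n → ZMod 2, l = List.ofFn d := by
    subst hlen; exact ⟨l.get, (List.ofFn_get l).symm⟩
  have hrev : List.ofFn (fun i => d i.rev) = (List.ofFn d).reverse := by
    apply List.ext_getElem
    · simp
    · intro i h1 h2
      simp only [List.getElem_ofFn, List.getElem_reverse, List.length_ofFn]
      congr 1
      ext
      simp only [Fin.val_rev]
      omega
  have hP : lhcaCharPoly n d = p := by rw [charpoly_eq, hl]
  have hr := PQ_rev (List.ofFn d)
  have hrd := (PQ_deg (List.ofFn d).reverse).2.2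
  have hrE := E_PQ (List.ofFn d).reverse
  rw [← hrev, hl] at hr
  rw [← hrev] at hrd hrE
  rw [hr.1] at hrd hrE
  simp only at hr hrd hrE
  have hPr : lhcaCharPoly n (fun i => d i.rev) = p := by rw [charpoly_eq, hr.1]
  have hne : (fun i => d i.rev) ≠ d := by
    intro h
    rw [h, hl] at hr
    obtain ⟨t, ht⟩ := hr.2
    simp only at ht
    have h3 : p ∣ ((X ^ 2 + X) * derivative p) * q := by
      refine ⟨t + (X ^ 2 + X) * derivative q + q + p, ?_⟩
      rw [E] at hqE
      grind
    rcases hp.prime.dvd_or_dvd h3 with h | h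
    · exact c_ndvd hp (by omega) h
    · have := eq_zero_of_dvd_of_degree_lt h hqd
      rw [this, zero_mul, zero_sub] at ht
      exact hp.not_dvd_one ⟨-t, by linear_combination -ht⟩
  have key : ∀ q', q'.degree < p.degree → E p q' = 1 → q' ≠ q →
      p ∣ (q' - q) + (X ^ 2 + X) * derivative p := by
    intro q' hd' hE' hne'
    have hk : L p (q' - q) = 0 := by
      rw [map_sub]
      rw [E_eq] at hE' hqE
      linear_combination hE' - hqE
    rcases hp.prime.dvd_or_dvd (ker_dvd hk) with h | h
    · exact absurd (eq_of_dvd hd' hqd h) hne'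
    · exact h
  refine ⟨d, hne, ?_⟩
  ext d'
  simp only [Set.mem_ofPred_eq, Set.mem_insert_iff, Set.mem_singleton_iff]
  constructor
  · intro h
    rw [charpoly_eq] at h
    have hd' := (PQ_deg (List.ofFn d')).2.2
    have hE' := E_PQ (List.ofFn d')
    rw [h] at hd' hE'
    by_cases hq' : (PQ (List.ofFn d')).2 = q
    · left
      exact List.ofFn_injective (PQ_inj _ _ (by rw [hl]; exact Prod.ext h hq'))
    · right
      have hqr : (PQ (List.ofFn fun i => d i.rev)).2 ≠ q := by
        intro h'
        exact hne (List.ofFn_injective (PQ_inj _ _ (by rw [hl]; exact Prod.ext hr.1 h')))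
      have h3 := dvd_sub (key _ hd' hE' hq') (key _ hrd hrE hqr)
      rw [add_sub_add_right_eq_sub, sub_sub_sub_cancel_right] at h3
      have h4 := eq_of_dvd hd' hrd h3
      exact List.ofFn_injective (PQ_inj _ _ (Prod.ext (h.trans hr.1.symm) h4))
  · rintro (rfl | rfl)
    · exact hP
    · exact hPr
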